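/- In the quantized Serre setup below, for every integer m with 2 ≤ m ≤ n one has [f_m, f_{ε_m}]_{q^{-1}} = 0, i.e. f_m·f_{ε_m} = q^{-1}·f_{ε_m}·f_m. -/

import Mathlib

/-- The twisted q-commutator `[u,v]_t = u*v - t*(v*u)`. -/
def qcomm {A : Type*} [Ring A] [Algebra ℂ A] (t : ℂ) (u v : A) : A :=
  u * v - t • (v * u)

theorem qcomm_qcomm_inv {A : Type*} [Ring A] [Algebra ℂ A] {q : ℂ} (hq : q ≠ 0) (x y : A) :
    qcomm q⁻¹ x (qcomm q x y) = x * x * y - (q + q⁻¹) • (x * y * x) + y * x * x := by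
  simp only [qcomm, mul_sub, sub_mul, smul_sub, mul_smul_comm, smul_mul_assoc, smul_smul,
    inv_mul_cancel₀ hq, mul_assoc]
  module

theorem qcomm_inv_qcomm_inv {A : Type*} [Ring A] [Algebra ℂ A] {q : ℂ} (hq : q ≠ 0) (x y : A) :
    qcomm q⁻¹ x (qcomm q⁻¹ y x) = -q⁻¹ • qcomm q⁻¹ x (qcomm q x y) := by
  rw [qcomm_qcomm_inv hq]
  simp only [qcomm, mul_sub, sub_mul, smul_sub, mul_smul_comm, smul_mul_assoc, mul_assoc]
  match_scalars <;> field_simp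
  ring

theorem Commute.qcomm_right {A : Type*} [Ring A] [Algebra ℂ A] {x u v : A} (t : ℂ)
    (hu : Commute x u) (hv : Commute x v) : Commute x (qcomm t u v) :=
  (hu.mul_right hv).sub_right ((hv.mul_right hu).smul_right t)

/-- Twisted commutation with `x` on the left passes through `qcomm s e` when `e` commutes
with `x`. -/
theorem qcomm_qcomm_of_commute {A : Type*} [Ring A] [Algebra ℂ A] {x e : A} (h : Commute x e)
    (s t : ℂ) (y : A) : qcomm t x (qcomm s e y) = qcomm s e (qcomm t x y) := by
  have h₁ : x * (e * y) = e * (x * y) := h.left_comm y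
  have h₂ : y * (x * e) = y * (e * x) := by rw [h.eq]
  simp only [qcomm, mul_sub, sub_mul, smul_sub, mul_smul_comm, smul_mul_assoc, mul_assoc, h₁, h₂]
  module

/-- In the quantized Serre setup, `[f_m, f_{ε_m}]_{q⁻¹} = 0` for `2 ≤ m ≤ n`,
i.e. `f_m·f_{ε_m} = q⁻¹·f_{ε_m}·f_m`. -/
theorem fm_qcomm_feps {A : Type*} [Ring A] [Algebra ℂ A]
    (q : ℂ) (hq : q ≠ 0) (hroot : ∀ k : ℕ, k ≠ 0 → q ^ k ≠ 1)
    (n : ℕ) (hn : 2 ≤ n) (f : ℕ → A)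
    (hR1 : ∀ i j, 1 ≤ i → i ≤ n → 1 ≤ j → j ≤ n →
      2 ≤ ((i : ℤ) - (j : ℤ)).natAbs → f i * f j = f j * f i)
    (hR2 : ∀ i j, 2 ≤ i → i ≤ n → 1 ≤ j → j ≤ n →
      ((i : ℤ) - (j : ℤ)).natAbs = 1 →
      qcomm q⁻¹ (f i) (qcomm q (f i) (f j)) = 0)
    (fδ : A) (hfδ : fδ = qcomm q⁻¹ (f 1) (qcomm q (f 1) (f 2)))
    (hR3 : f 1 * fδ = fδ * f 1)
    (fε : ℕ → A) (hfε1 : fε 1 = f 1)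
    (hfεs : ∀ i, 1 ≤ i → i < n → fε (i + 1) = qcomm q⁻¹ (fε i) (f (i + 1))) :
    ∀ m, 2 ≤ m → m ≤ n →
      qcomm q⁻¹ (f m) (fε m) = 0 ∧ f m * fε m = q⁻¹ • (fε m * f m) := by
  have hcomm : ∀ i, 1 ≤ i → ∀ j, i + 2 ≤ j → j ≤ n → Commute (f j) (fε i) := by
    intro i hi
    induction i, hi using Nat.le_induction with
    | base =>
      intro j hij hj
      rw [hfε1]
      exact hR1 j 1 (by omega) hj le_rfl (by omega) (by omega)
    | succ i hi ih =>
      intro j hij hj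
      rw [hfεs i hi (by omega)]
      exact (ih j (by omega) hj).qcomm_right _
        (hR1 j (i + 1) (by omega) hj (by omega) (by omega) (by omega))
  have hserre : ∀ i, 1 ≤ i → i < n →
      qcomm q⁻¹ (f (i + 1)) (qcomm q (f (i + 1)) (fε i)) = 0 := by
    intro i hi hin
    obtain rfl | ⟨k, hk, rfl⟩ : i = 1 ∨ ∃ k, 1 ≤ k ∧ i = k + 1 := by
      rcases hi.eq_or_lt with h | h
      · exact .inl h.symm
      · exact .inr ⟨i - 1, by omega, by omega⟩
    · rw [hfε1]
      exact hR2 2 1 le_rfl hn le_rfl (by omega) (by omega)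
    · have hc := hcomm k hk (k + 1 + 1) le_rfl hin
      rw [hfεs k hk (by omega), qcomm_qcomm_of_commute hc, qcomm_qcomm_of_commute hc,
        hR2 (k + 1 + 1) (k + 1) (by omega) hin (by omega) (by omega) (by omega)]
      simp [qcomm]
  intro m hm hmn
  obtain ⟨i, rfl⟩ : ∃ i, m = i + 1 := ⟨m - 1, by omega⟩
  have key : qcomm q⁻¹ (f (i + 1)) (fε (i + 1)) = 0 := by
    rw [hfεs i (by omega) (by omega), qcomm_inv_qcomm_inv hq, hserre i (by omega) (by omega),
      smul_zero]
  exact ⟨key, sub_eq_zero.mp key⟩
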